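/- Fix an integer K ≥ 1 and a real ρ_V > 0 with ρ_V ≠ 1. Let r : (0,∞) → ℝ be a function such that for every a > 0 one has 0 ≤ r(a) < a and f_a(ρ_V, r(a)) = 0. Then, as a → 0⁺: (i) r(a)/a → ρ_V·(1 − ρ_V^K)/(1 − ρ_V^{K+1}); (ii) s̃(ρ_V, r(a)) → (Σ_{k=0}^{K} k·ρ_V^k)/(Σ_{k=0}^{K} ρ_V^k); and (iii) P_b(ρ_V, r(a)) → 1 − (ρ_V^K − ρ_V)/(ρ_V^{K+1} − 1). -/

import Mathlib

open Finset

/-- Partition function `Z(ρ_V, ρ_R) = Σ_{k+l ≤ K} ρ_V^k ρ_R^l / l!`. -/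
noncomputable def Z (K : ℕ) (x r : ℝ) : ℝ :=
  ∑ k ∈ Finset.range (K + 1), ∑ l ∈ Finset.range (K + 1 - k),
    x ^ k * r ^ l / (Nat.factorial l : ℝ)

/-- Stationary probability `π_{k,l}`. -/
noncomputable def piP (K : ℕ) (x r : ℝ) (k l : ℕ) : ℝ :=
  x ^ k * r ^ l / ((Nat.factorial l : ℝ) * Z K x r)

/-- `π_{0,·}` : probability of an empty station (no vehicles). -/
noncomputable def piZero (K : ℕ) (x r : ℝ) : ℝ :=
  ∑ l ∈ Finset.range (K + 1), piP K x r 0 l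

/-- `π_S` : probability of a saturated station. -/
noncomputable def piSat (K : ℕ) (x r : ℝ) : ℝ :=
  ∑ k ∈ Finset.range (K + 1), piP K x r k (K - k)

/-- Mean occupancy `s̃(ρ_V,ρ_R)`. -/
noncomputable def sTilde (K : ℕ) (x r : ℝ) : ℝ :=
  (∑ k ∈ Finset.range (K + 1), ∑ l ∈ Finset.range (K + 1 - k),
    ((k : ℝ) + (l : ℝ)) * (x ^ k * r ^ l / (Nat.factorial l : ℝ))) / Z K x r

/-- `f(ρ_V,ρ_R) = (a − ρ_R)·Z(ρ_V,ρ_R) − a·Σ_{l=0}^K ρ_R^l/l!`. -/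
noncomputable def fEq (K : ℕ) (a x r : ℝ) : ℝ :=
  (a - r) * Z K x r - a * ∑ l ∈ Finset.range (K + 1), r ^ l / (Nat.factorial l : ℝ)

/-- Proportion of problematic stations `P_b`. -/
noncomputable def Pb (K : ℕ) (x r : ℝ) : ℝ :=
  piZero K x r + piSat K x r - piP K x r 0 K

/-- Upper bound `P_b^+`. -/
noncomputable def PbPlus (K : ℕ) (x r : ℝ) : ℝ :=
  piZero K x r + piSat K x r

theorem Z_zero_right (K : ℕ) (x : ℝ) : Z K x 0 = ∑ k ∈ Finset.range (K + 1), x ^ k := by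
  refine Finset.sum_congr rfl fun k hk => ?_
  rw [Nat.sub_add_comm (Nat.lt_succ_iff.1 (Finset.mem_range.1 hk)), Finset.sum_range_succ']
  simp

theorem Z_pos (K : ℕ) {x r : ℝ} (hx : 0 < x) (hr : 0 ≤ r) : 0 < Z K x r := by
  refine Finset.sum_pos (fun k hk => ?_) (by simp)
  rw [Nat.sub_add_comm (Nat.lt_succ_iff.1 (Finset.mem_range.1 hk)), Finset.sum_range_succ']
  have h : 0 ≤ ∑ l ∈ Finset.range (K - k),
      x ^ k * r ^ (l + 1) / (Nat.factorial (l + 1) : ℝ) :=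
    Finset.sum_nonneg fun l _ => by positivity
  have hk : 0 < x ^ k * r ^ 0 / (Nat.factorial 0 : ℝ) := by simpa using pow_pos hx k
  exact add_pos_of_nonneg_of_pos h hk

theorem continuous_Z (K : ℕ) (x : ℝ) : Continuous (Z K x) := by
  unfold Z
  fun_prop

theorem continuousAt_piP (K : ℕ) {x r : ℝ} (h : Z K x r ≠ 0) (k l : ℕ) :
    ContinuousAt (fun r => piP K x r k l) r := by
  refine ContinuousAt.div (by fun_prop)
    (continuousAt_const.mul (continuous_Z K x).continuousAt) ?_
  exact mul_ne_zero (by positivity) h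

theorem continuousAt_Pb (K : ℕ) {x r : ℝ} (h : Z K x r ≠ 0) :
    ContinuousAt (Pb K x) r := by
  have hp := continuousAt_piP K h
  have hzero : ContinuousAt (piZero K x) r :=
    tendsto_finsetSum _ fun l _ => hp 0 l
  have hsat : ContinuousAt (piSat K x) r :=
    tendsto_finsetSum _ fun k _ => hp k (K - k)
  exact (hzero.add hsat).sub (hp 0 K)

theorem continuousAt_sTilde (K : ℕ) {x r : ℝ} (h : Z K x r ≠ 0) :
    ContinuousAt (sTilde K x) r :=
  ContinuousAt.div (by fun_prop) (continuous_Z K x).continuousAt h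

theorem sTilde_zero_right (K : ℕ) (x : ℝ) :
    sTilde K x 0 = (∑ k ∈ Finset.range (K + 1), (k : ℝ) * x ^ k)
      / (∑ k ∈ Finset.range (K + 1), x ^ k) := by
  rw [sTilde, Z_zero_right]
  congr 1
  refine Finset.sum_congr rfl fun k hk => ?_
  rw [Nat.sub_add_comm (Nat.lt_succ_iff.1 (Finset.mem_range.1 hk)), Finset.sum_range_succ']
  simp

theorem piZero_zero_right (K : ℕ) (x : ℝ) : piZero K x 0 = 1 / Z K x 0 := by
  rw [piZero, Finset.sum_range_succ']
  simp [piP]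

theorem piSat_zero_right (K : ℕ) (x : ℝ) : piSat K x 0 = x ^ K / Z K x 0 := by
  rw [piSat, Finset.sum_range_succ, Finset.sum_eq_zero]
  · simp [piP]
  · intro k hk
    have hne : K - k ≠ 0 := (Nat.sub_pos_of_lt (Finset.mem_range.1 hk)).ne'
    simp [piP, hne]

theorem Pb_zero_right {K : ℕ} (hK : 1 ≤ K) (x : ℝ) :
    Pb K x 0 = (1 + x ^ K) / Z K x 0 := by
  have hne : K ≠ 0 := Nat.one_le_iff_ne_zero.1 hK
  rw [Pb, piZero_zero_right, piSat_zero_right, add_div]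
  simp [piP, hne]

theorem div_eq_of_fEq_eq_zero {K : ℕ} {a x r : ℝ} (ha : a ≠ 0) (hZ : Z K x r ≠ 0)
    (h : fEq K a x r = 0) :
    r / a = 1 - (∑ l ∈ Finset.range (K + 1), r ^ l / (Nat.factorial l : ℝ)) / Z K x r := by
  rw [fEq] at h
  field_simp
  linarith

/-- Light-traffic asymptotics: as a → 0⁺, the equilibrium quantities converge. -/
theorem stmt_18 (K : ℕ) (hK : 1 ≤ K) (x : ℝ) (hx : 0 < x) (hx1 : x ≠ 1)
    (r : ℝ → ℝ) (hr : ∀ a : ℝ, 0 < a → 0 ≤ r a ∧ r a < a ∧ fEq K a x (r a) = 0) :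
    Filter.Tendsto (fun a => r a / a) (nhdsWithin 0 (Set.Ioi 0))
      (nhds (x * (1 - x ^ K) / (1 - x ^ (K + 1))))
    ∧ Filter.Tendsto (fun a => sTilde K x (r a)) (nhdsWithin 0 (Set.Ioi 0))
      (nhds ((∑ k ∈ Finset.range (K + 1), (k : ℝ) * x ^ k)
        / (∑ k ∈ Finset.range (K + 1), x ^ k)))
    ∧ Filter.Tendsto (fun a => Pb K x (r a)) (nhdsWithin 0 (Set.Ioi 0))
      (nhds (1 - (x ^ K - x) / (x ^ (K + 1) - 1))) := by
  have hZ : Z K x 0 ≠ 0 := (Z_pos K hx le_rfl).ne'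
  have hpow : x ^ (K + 1) - 1 ≠ 0 :=
    sub_ne_zero.2 fun h => hx1 ((pow_eq_one_iff_of_nonneg hx.le K.succ_ne_zero).1 h)
  have hpow' : 1 - x ^ (K + 1) ≠ 0 := fun h => hpow (by linarith)
  have hx1' : x - 1 ≠ 0 := sub_ne_zero.2 hx1
  have hgeom : Z K x 0 = (x ^ (K + 1) - 1) / (x - 1) := by
    rw [Z_zero_right, geom_sum_eq hx1]
  have hr0 : Filter.Tendsto r (nhdsWithin 0 (Set.Ioi 0)) (nhds 0) := by
    refine tendsto_of_tendsto_of_tendsto_of_le_of_le' tendsto_const_nhds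
      (tendsto_nhdsWithin_of_tendsto_nhds Filter.tendsto_id) ?_ ?_
    · filter_upwards [self_mem_nhdsWithin] with a ha using (hr a ha).1
    · filter_upwards [self_mem_nhdsWithin] with a ha using (hr a ha).2.1.le
  refine ⟨?_, ?_, ?_⟩
  · have hcont : ContinuousAt (fun r : ℝ => 1 -
        (∑ l ∈ Finset.range (K + 1), r ^ l / (Nat.factorial l : ℝ)) / Z K x r) 0 :=
      continuousAt_const.sub
        (ContinuousAt.div (by fun_prop) (continuous_Z K x).continuousAt hZ)
    have hval : 1 - (∑ l ∈ Finset.range (K + 1), (0 : ℝ) ^ l / (Nat.factorial l : ℝ)) / Z K x 0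
        = x * (1 - x ^ K) / (1 - x ^ (K + 1)) := by
      rw [Finset.sum_range_succ', hgeom]
      simp
      field_simp
      ring
    rw [← hval]
    refine (hcont.tendsto.comp hr0).congr' ?_
    filter_upwards [self_mem_nhdsWithin] with a ha
    obtain ⟨h0, -, h⟩ := hr a ha
    exact (div_eq_of_fEq_eq_zero (ne_of_gt ha) (Z_pos K hx h0).ne' h).symm
  · rw [← sTilde_zero_right]
    exact (continuousAt_sTilde K hZ).tendsto.comp hr0
  · have hval : Pb K x 0 = 1 - (x ^ K - x) / (x ^ (K + 1) - 1) := by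
      rw [Pb_zero_right hK, hgeom]
      field_simp
      ring
    rw [← hval]
    exact (continuousAt_Pb K hZ).tendsto.comp hr0
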